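/- For every integer m ≥ 0 and every real α > 2, the word B_α(m) has length at most 4·m·log₂(α·m)/log₂(α−1) (where the bound is interpreted as 0 when m = 0). -/

import Mathlib

/-- Shapes of binary trees: `nil` is the empty tree, `node l r` has a root with left
subtree `l` and right subtree `r`. -/
inductive BT : Type
  | nil : BT
  | node (l r : BT) : BT
deriving DecidableEq

namespace BT

/-- Number of nodes of a binary tree. -/
def size : BT → ℕ
  | nil => 0
  | node l r => l.size + r.size + 1

end BT

/-- The tree `T_α(m)`: empty if `m = 0`, otherwise a root whose left subtree is
`T_{α(α-1)}(⌊m/α⌋)` and whose right subtree is `T_α(m - ⌊m/α⌋ - 1)`. -/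
noncomputable def Ttree (m : ℕ) (α : ℝ) (hα : 2 < α) : BT :=
  if h : m = 0 then BT.nil
  else
    BT.node (Ttree ⌊(m : ℝ) / α⌋₊ (α * (α - 1)) (by nlinarith))
      (Ttree (m - ⌊(m : ℝ) / α⌋₊ - 1) α hα)
termination_by m
decreasing_by
  · have hm : 0 < m := Nat.pos_of_ne_zero h
    have h0 : (0 : ℝ) ≤ (m : ℝ) / α := div_nonneg (by positivity) (by linarith)
    rw [Nat.floor_lt h0]
    exact div_lt_self (by exact_mod_cast hm) (by linarith)
  · omega

namespace BT

/-- The full index-barrier of a tree whose root carries the label `n`, in the variant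
where the one-child case doubles the root letter: `B(i) = i` for a leaf,
`B(i) = i ∘ i ∘ B(i-1) ∘ i ∘ i` if `i` has exactly one child, and
`B(i) = i ∘ B(i⁻) ∘ i ∘ B(i⁺) ∘ i ∘ B(i⁻) ∘ i` if `i` has two children (with
`i⁻ = i - 1` the left child and `i⁺ = i - 1 - size(left subtree)` the right child);
the barrier of the empty tree is the empty word.  Labels are assigned so that the
left-first depth-first (preorder) traversal visits them in decreasing order. -/
def barrier2 : BT → ℕ → List ℕ
  | nil, _ => []
  | node nil nil, n => [n]
  | node nil (node rl rr), n => [n, n] ++ barrier2 (node rl rr) (n - 1) ++ [n, n]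
  | node (node ll lr) nil, n => [n, n] ++ barrier2 (node ll lr) (n - 1) ++ [n, n]
  | node (node ll lr) (node rl rr), n =>
      [n] ++ barrier2 (node ll lr) (n - 1) ++ [n] ++
      barrier2 (node rl rr) (n - 1 - (node ll lr).size) ++ [n] ++
      barrier2 (node ll lr) (n - 1) ++ [n]

end BT

namespace BT

theorem length_barrier2_node_le (l r : BT) (n : ℕ) :
    ∃ a b : ℕ, ((node l r).barrier2 n).length ≤
      4 + 2 * (l.barrier2 a).length + (r.barrier2 b).length := by
  refine ⟨n - 1, if l = nil then n - 1 else n - 1 - l.size, ?_⟩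
  cases l <;> cases r <;> simp [barrier2] <;> omega

end BT

theorem natCast_mul_logb_le {β J : ℝ} (hβ : 0 < β) (j : ℕ) (h : β * j ≤ J) :
    (j : ℝ) * Real.logb 2 (β * j) ≤ j * Real.logb 2 J := by
  rcases Nat.eq_zero_or_pos j with rfl | hj
  · simp
  · have hj' : (0 : ℝ) < j := by exact_mod_cast hj
    exact mul_le_mul_of_nonneg_left
      (Real.logb_le_logb_of_le (by norm_num) (by positivity) h) hj'.le

theorem two_mul_logb_sub_one_le {α : ℝ} (hα : 2 < α) :
    2 * Real.logb 2 (α - 1) ≤ Real.logb 2 (α * (α - 1) - 1) := by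
  have h : Real.logb 2 ((α - 1) ^ 2) ≤ Real.logb 2 (α * (α - 1) - 1) :=
    Real.logb_le_logb_of_le (by norm_num) (by nlinarith) (by nlinarith)
  rw [Real.logb_pow] at h
  exact_mod_cast h

theorem length_barrier2_Ttree_le (m : ℕ) : ∀ (α : ℝ) (hα : 2 < α) (n : ℕ),
    (((Ttree m α hα).barrier2 n).length : ℝ) ≤
      4 * m * Real.logb 2 (α * m) / Real.logb 2 (α - 1) := by
  induction m using Nat.strong_induction_on with
  | _ m ih =>
    intro α hα n
    rcases Nat.eq_zero_or_pos m with rfl | hm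
    · rw [Ttree]
      simp [BT.barrier2]
    have hm1 : (1 : ℝ) ≤ m := by exact_mod_cast hm
    have hα0 : 0 < α := by linarith
    have hdiv : (m : ℝ) / α < m := div_lt_self (by linarith) (by linarith)
    rw [Ttree, dif_neg hm.ne']
    set k := ⌊(m : ℝ) / α⌋₊
    have hkm : k < m := (Nat.floor_lt (by positivity)).2 hdiv
    have hk_le : (k : ℝ) * α ≤ m :=
      (le_div_iff₀ hα0).1 (Nat.floor_le (by positivity))
    have hk_lt : (m : ℝ) < (k + 1) * α :=
      (div_lt_iff₀ hα0).1 (Nat.lt_floor_add_one _)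
    have hcast : ((m - k - 1 : ℕ) : ℝ) = m - k - 1 := by
      rw [Nat.cast_sub (by omega), Nat.cast_sub hkm.le, Nat.cast_one]
    obtain ⟨a, b, hab⟩ := BT.length_barrier2_node_le
      (Ttree k (α * (α - 1)) (by nlinarith)) (Ttree (m - k - 1) α hα) n
    have hl := ih k hkm (α * (α - 1)) (by nlinarith) a
    have hr := ih (m - k - 1) (by omega) α hα b
    have hab' := (Nat.cast_le (α := ℝ)).2 hab
    push_cast at hab'
    set D := Real.logb 2 (α - 1)
    set X := Real.logb 2 ((α - 1) * m)
    have hD0 : 0 < D := Real.logb_pos (by norm_num) (by linarith)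
    have hDX : D ≤ X :=
      Real.logb_le_logb_of_le (by norm_num) (by linarith) (by nlinarith)
    have hXm : X ≤ Real.logb 2 (α * m) :=
      Real.logb_le_logb_of_le (by norm_num) (by nlinarith) (by nlinarith)
    have hl' : (4 * k * Real.logb 2 (α * (α - 1) * k) / Real.logb 2 (α * (α - 1) - 1) : ℝ) ≤
        4 * (k * X) / (2 * D) := by
      have h := natCast_mul_logb_le (β := α * (α - 1)) (J := (α - 1) * m)
        (by nlinarith) k (by nlinarith)
      refine div_le_div₀ ?_ (by linarith) (by positivity) (two_mul_logb_sub_one_le hα)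
      have : 0 ≤ X := by linarith
      positivity
    have hr' : (4 * (m - k - 1 : ℕ) * Real.logb 2 (α * (m - k - 1 : ℕ)) / D : ℝ) ≤
        4 * ((m - k - 1) * X) / D := by
      have h := natCast_mul_logb_le (J := (α - 1) * m) hα0 (m - k - 1)
        (by rw [hcast]; nlinarith)
      refine div_le_div_of_nonneg_right ?_ hD0.le
      rw [← hcast]
      linarith
    have hone : 1 ≤ X / D := (one_le_div hD0).2 hDX
    calc _ ≤ 4 + 2 * (4 * (k * X) / (2 * D)) + 4 * ((m - k - 1) * X) / D := by linarith
      _ = 4 + 4 * (m - 1) * (X / D) := by field_simp; ring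
      _ ≤ 4 * m * (X / D) := by linarith
      _ = 4 * m * X / D := by ring
      _ ≤ _ := by gcongr

theorem barrier2_length_le (m : ℕ) (α : ℝ) (hα : 2 < α) :
    (((Ttree m α hα).barrier2 m).length : ℝ) ≤
      4 * m * Real.logb 2 (α * m) / Real.logb 2 (α - 1) :=
  length_barrier2_Ttree_le m α hα m
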